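/- Assume M is ∞-spanned and the indexing of the generators is adapted as in the Labelling lemma. Then the geodesic automaton Geo with the start state ∅ removed is strongly connected: for any two reachable non-fail states D and D', both different from ∅, there exists a word u over {1, …, n} such that all transitions along u starting from D are defined and δ̂(D, u) = D'. -/

import Mathlib

open scoped BigOperators

/-- The simple root `α_i`, the `i`-th standard basis vector of `ℝ^n`. -/
noncomputable def simpleRoot {n : ℕ} (i : Fin n) : Fin n → ℝ := Pi.single i 1

/-- The symmetric bilinear form `B` associated to the Coxeter matrix `M`, determined by
`B(α_i, α_j) = -cos (π / M i j)` when `M i j ≠ 0` and `B(α_i, α_j) = -1` when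
`M i j = 0` (the label `∞`). -/
noncomputable def bform {n : ℕ} (M : CoxeterMatrix (Fin n)) (u v : Fin n → ℝ) : ℝ :=
  ∑ i, ∑ j, u i * (if M i j = 0 then -1 else -Real.cos (Real.pi / (M i j))) * v j

/-- The simple reflection `σ_i(v) = v - 2 B(v, α_i) α_i`. -/
noncomputable def simpleRefl {n : ℕ} (M : CoxeterMatrix (Fin n)) (i : Fin n)
    (v : Fin n → ℝ) : Fin n → ℝ :=
  v - (2 * bform M v (simpleRoot i)) • simpleRoot i

/-- The set `Σ` of small roots of `M`: the smallest set of vectors containing the simple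
roots `α_1, …, α_n` and such that whenever `v ∈ Σ` and `-1 < B(v, α_i) < 0`, also
`σ_i(v) ∈ Σ`. -/
inductive IsSmallRoot {n : ℕ} (M : CoxeterMatrix (Fin n)) : (Fin n → ℝ) → Prop
  | simple (i : Fin n) : IsSmallRoot M (simpleRoot i)
  | reflect {v : Fin n → ℝ} (i : Fin n) : IsSmallRoot M v →
      -1 < bform M v (simpleRoot i) → bform M v (simpleRoot i) < 0 →
      IsSmallRoot M (simpleRefl M i v)

/-- The transition function of the geodesic automaton `Geo` (defined when `α_i ∉ D`):
`δ(D, i) = {α_i} ∪ (σ_i(D) ∩ Σ)`. -/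
noncomputable def stepGeo {n : ℕ} (M : CoxeterMatrix (Fin n)) (D : Set (Fin n → ℝ))
    (i : Fin n) : Set (Fin n → ℝ) :=
  insert (simpleRoot i) (simpleRefl M i '' D ∩ {v | IsSmallRoot M v})

/-- The transition function of the shortlex automaton `ShortLex` (defined when `α_i ∉ D`):
`δ(D, i) = {α_i} ∪ ((σ_i(D) ∪ {σ_i(α_l) : l < i}) ∩ Σ)`. -/
noncomputable def stepSL {n : ℕ} (M : CoxeterMatrix (Fin n)) (D : Set (Fin n → ℝ))
    (i : Fin n) : Set (Fin n → ℝ) :=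
  insert (simpleRoot i)
    ((simpleRefl M i '' D ∪ simpleRefl M i '' {v | ∃ l : Fin n, l < i ∧ v = simpleRoot l})
      ∩ {v | IsSmallRoot M v})

/-- All transitions of the automaton with transition function `step` are defined (do not
fail) when reading the word `u` from the state `D`; a transition out of `D` along the letter
`i` is defined exactly when `α_i ∉ D`. -/
def DefinedFrom {n : ℕ} (step : Set (Fin n → ℝ) → Fin n → Set (Fin n → ℝ)) :
    Set (Fin n → ℝ) → List (Fin n) → Prop
  | _, [] => True
  | D, i :: u => simpleRoot i ∉ D ∧ DefinedFrom step (step D i) u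

/-- The enhanced transition function `δ̂(D, u)`: the state obtained by reading the word `u`
from the state `D`. -/
def run {n : ℕ} (step : Set (Fin n → ℝ) → Fin n → Set (Fin n → ℝ))
    (D : Set (Fin n → ℝ)) (u : List (Fin n)) : Set (Fin n → ℝ) :=
  u.foldl step D

/-- A state is reachable if it is obtained from the start state `∅` by reading some word all
of whose transitions are defined. -/
def Reachable {n : ℕ} (step : Set (Fin n → ℝ) → Fin n → Set (Fin n → ℝ))
    (D : Set (Fin n → ℝ)) : Prop :=
  ∃ u : List (Fin n), DefinedFrom step ∅ u ∧ run step ∅ u = D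

/-- The graph of `∞`-edges of the Coxeter matrix `M`: `i ≠ j` are adjacent iff `M i j = 0`. -/
def infGraph {n : ℕ} (M : CoxeterMatrix (Fin n)) : SimpleGraph (Fin n) :=
  SimpleGraph.fromRel (fun i j => M i j = 0)

/-- The indexing of the generators is adapted as in the Labelling lemma: there is a spanning
tree `Γ` of the graph of `∞`-edges containing the edges `{1,2}` and `{2,3}`, such that along
every simple path in `Γ` from the vertex `1` to a leaf of `Γ` the labels strictly increase.
(Vertices `1, 2, 3` correspond to the indices `0, 1, 2` of `Fin n`.) -/
def AdaptedLabelling {n : ℕ} (hn : 3 ≤ n) (M : CoxeterMatrix (Fin n)) : Prop :=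
  ∃ Γ : SimpleGraph (Fin n), Γ ≤ infGraph M ∧ Γ.Connected ∧ Γ.IsAcyclic ∧
    Γ.Adj ⟨0, by omega⟩ ⟨1, by omega⟩ ∧ Γ.Adj ⟨1, by omega⟩ ⟨2, by omega⟩ ∧
    ∀ (v : Fin n) (p : Γ.Walk ⟨0, by omega⟩ v), p.IsPath → (∃! w : Fin n, Γ.Adj v w) →
      p.support.Chain' (· < ·)

section SmallRoots

variable {n : ℕ} (M : CoxeterMatrix (Fin n))

/-- The Gram matrix entry `B(α_i, α_j)`. -/
noncomputable def gramEntry (i j : Fin n) : ℝ :=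
  if M i j = 0 then -1 else -Real.cos (Real.pi / (M i j))

lemma bform_simpleRoot (v : Fin n → ℝ) (j : Fin n) :
    bform M v (simpleRoot j) = ∑ i, v i * gramEntry M i j := by
  simp [bform, simpleRoot, gramEntry, Pi.single_apply]

lemma gramEntry_self (i : Fin n) : gramEntry M i i = 1 := by
  simp [gramEntry]

lemma gramEntry_of_eq_zero {i j : Fin n} (h : M i j = 0) : gramEntry M i j = -1 := by
  simp [gramEntry, h]

lemma gramEntry_eq_zero_or_le {i j : Fin n} (hij : i ≠ j) :
    gramEntry M i j = 0 ∨ gramEntry M i j ≤ -(1 / 2) := by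
  have h1 : M i j ≠ 1 := M.off_diagonal i j hij
  unfold gramEntry
  split_ifs with h0
  · right; norm_num
  · rcases eq_or_ne (M i j) 2 with h2 | h2
    · left; simp [h2]
    · right
      have h3 : (3 : ℝ) ≤ M i j := by
        have : 3 ≤ M i j := by omega
        exact_mod_cast this
      have hle : Real.pi / (M i j) ≤ Real.pi / 3 :=
        div_le_div_of_nonneg_left Real.pi_pos.le (by norm_num) h3
      have := Real.cos_le_cos_of_nonneg_of_le_pi (by positivity)
        (by linarith [Real.pi_pos]) hle
      rw [Real.cos_pi_div_three] at this
      linarith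

lemma gramEntry_nonpos {i j : Fin n} (hij : i ≠ j) : gramEntry M i j ≤ 0 := by
  rcases gramEntry_eq_zero_or_le M hij with h | h <;> linarith

lemma simpleRefl_apply_self (i : Fin n) (v : Fin n → ℝ) :
    simpleRefl M i v i = v i - 2 * bform M v (simpleRoot i) := by
  simp [simpleRefl, simpleRoot]

lemma simpleRefl_apply_of_ne {i k : Fin n} (hk : k ≠ i) (v : Fin n → ℝ) :
    simpleRefl M i v k = v k := by
  simp [simpleRefl, simpleRoot, hk]

variable {M}

lemma mul_gramEntry_nonpos {v : Fin n → ℝ} (hv : ∀ k, 0 ≤ v k) {i : Fin n} (hi : v i = 0)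
    (k : Fin n) : v k * gramEntry M k i ≤ 0 := by
  rcases eq_or_ne k i with rfl | hk
  · simp [hi]
  · exact mul_nonpos_of_nonneg_of_nonpos (hv k) (gramEntry_nonpos M hk)

lemma bform_simpleRoot_le {v : Fin n → ℝ} (hv : ∀ k, 0 ≤ v k) {i : Fin n} (hi : v i = 0)
    (k : Fin n) : bform M v (simpleRoot i) ≤ v k * gramEntry M k i := by
  rw [bform_simpleRoot, ← Finset.add_sum_erase _ _ (Finset.mem_univ k)]
  have := Finset.sum_nonpos (s := Finset.univ.erase k)
    (fun l _ => mul_gramEntry_nonpos (M := M) hv hi l)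
  linarith

/-- If every nonzero coefficient of `v` is at least `1` and `B(v, α_i) < 0`, then the `i`-th
coefficient of `σ_i(v)` is at least `1`. -/
lemma one_le_simpleRefl_apply_self {v : Fin n → ℝ} (hv : ∀ k, v k = 0 ∨ 1 ≤ v k) {i : Fin n}
    (hneg : bform M v (simpleRoot i) < 0) : 1 ≤ simpleRefl M i v i := by
  have hnonneg : ∀ k, 0 ≤ v k := fun k => by rcases hv k with h | h <;> linarith
  rw [simpleRefl_apply_self]
  rcases hv i with hi | hi
  · obtain ⟨k, -, hk⟩ : ∃ k ∈ Finset.univ, v k * gramEntry M k i < 0 := by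
      by_contra! hcon
      rw [bform_simpleRoot] at hneg
      exact absurd (Finset.sum_nonneg hcon) (not_le.mpr hneg)
    have hle := bform_simpleRoot_le (M := M) hnonneg hi k
    have hki : k ≠ i := by rintro rfl; simp [hi] at hk
    have hvk : 1 ≤ v k := (hv k).resolve_left (by intro h; simp [h] at hk)
    have hg : gramEntry M k i ≤ -(1 / 2) :=
      (gramEntry_eq_zero_or_le M hki).resolve_left (by intro h; simp [h] at hk)
    nlinarith
  · linarith

/-- Small roots have nonnegative coefficients, the nonzero ones being at least `1`. -/
lemma IsSmallRoot.eq_zero_or_one_le {v : Fin n → ℝ} (hv : IsSmallRoot M v) :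
    ∀ k, v k = 0 ∨ 1 ≤ v k := by
  induction hv with
  | simple i =>
    intro k
    rcases eq_or_ne k i with rfl | h
    · right; simp [simpleRoot]
    · left; simp [simpleRoot, h]
  | @reflect v i _ _ hneg ih =>
    intro k
    rcases eq_or_ne k i with rfl | h
    · exact Or.inr (one_le_simpleRefl_apply_self ih hneg)
    · rw [simpleRefl_apply_of_ne M h]
      exact ih k

lemma IsSmallRoot.nonneg {v : Fin n → ℝ} (hv : IsSmallRoot M v) (k : Fin n) : 0 ≤ v k := by
  rcases hv.eq_zero_or_one_le k with h | h <;> linarith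

lemma ne_of_eq_zero {i j : Fin n} (h : M i j = 0) : i ≠ j := by
  rintro rfl
  simp at h

lemma IsSmallRoot.bform_le_neg_one {v : Fin n → ℝ} (hv : IsSmallRoot M v) {i j : Fin n}
    (hM : M i j = 0) (hi : v i ≠ 0) (hj : v j = 0) : bform M v (simpleRoot j) ≤ -1 := by
  have h := bform_simpleRoot_le (M := M) hv.nonneg hj i
  have h1 := (hv.eq_zero_or_one_le i).resolve_left hi
  rw [gramEntry_of_eq_zero M hM] at h
  linarith

/-- The support of a small root contains no `∞`-edge. -/
lemma IsSmallRoot.eq_zero_or_eq_zero {v : Fin n → ℝ} (hv : IsSmallRoot M v) :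
    ∀ a b, M a b = 0 → v a = 0 ∨ v b = 0 := by
  induction hv with
  | simple i =>
    intro a b hab
    have hne := ne_of_eq_zero hab
    by_cases ha : a = i
    · right; subst ha; simp [simpleRoot, hne.symm]
    · left; simp [simpleRoot, ha]
  | @reflect v i hv hgt _ ih =>
    have key : ∀ b, M b i = 0 → v b = 0 := by
      intro b hb
      by_contra hvb
      have := hv.bform_le_neg_one hb hvb ((ih b i hb).resolve_left hvb)
      linarith
    intro a b hab
    have hne := ne_of_eq_zero hab
    by_cases ha : a = i
    · subst ha
      right
      rw [simpleRefl_apply_of_ne M hne.symm]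
      exact key b (by rw [M.symmetric]; exact hab)
    · by_cases hb : b = i
      · subst hb
        left
        rw [simpleRefl_apply_of_ne M hne]
        exact key a hab
      · rw [simpleRefl_apply_of_ne M ha, simpleRefl_apply_of_ne M hb]
        exact ih a b hab

/-- A small root supported on a single index is the corresponding simple root. -/
lemma IsSmallRoot.eq_simpleRoot {v : Fin n → ℝ} (hv : IsSmallRoot M v) :
    ∀ j, (∀ k, k ≠ j → v k = 0) → v = simpleRoot j := by
  induction hv with
  | simple i =>
    intro j hj
    by_cases h : i = j
    · rw [h]
    · simpa [simpleRoot] using hj i h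
  | @reflect v i hv _ hneg ih =>
    intro j hj
    exfalso
    by_cases h : i = j
    · subst h
      have hvi : v = simpleRoot i := ih i fun k hk => by
        rw [← simpleRefl_apply_of_ne M hk v]; exact hj k hk
      have : bform M v (simpleRoot i) = 1 := by
        rw [hvi, bform_simpleRoot]
        simp [simpleRoot, Pi.single_apply, gramEntry_self]
      linarith
    · have := one_le_simpleRefl_apply_self hv.eq_zero_or_one_le hneg
      rw [hj i h] at this
      linarith

/-- Reflecting a small root across an `∞`-neighbour of its support leaves the set of small
roots. -/
lemma IsSmallRoot.not_isSmallRoot_simpleRefl {v : Fin n → ℝ} (hv : IsSmallRoot M v)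
    {i j : Fin n} (hM : M i j = 0) (hi : v i ≠ 0) : ¬ IsSmallRoot M (simpleRefl M j v) := by
  intro hs
  have hj : v j = 0 := (hv.eq_zero_or_eq_zero i j hM).resolve_left hi
  have hB := hv.bform_le_neg_one hM hi hj
  rcases hs.eq_zero_or_eq_zero i j hM with h | h
  · rw [simpleRefl_apply_of_ne M (ne_of_eq_zero hM)] at h
    exact hi h
  · rw [simpleRefl_apply_self, hj] at h
    linarith

end SmallRoots

section Paths

variable {n : ℕ}

lemma definedFrom_append (step : Set (Fin n → ℝ) → Fin n → Set (Fin n → ℝ))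
    (D : Set (Fin n → ℝ)) (u w : List (Fin n)) :
    DefinedFrom step D (u ++ w) ↔
      DefinedFrom step D u ∧ DefinedFrom step (run step D u) w := by
  induction u generalizing D with
  | nil => simp [DefinedFrom, run]
  | cons i u ih => simp [DefinedFrom, ih, run, and_assoc]

/-- The state `E` is obtained from `D` by reading a word all of whose transitions are
defined. -/
def Leads (step : Set (Fin n → ℝ) → Fin n → Set (Fin n → ℝ)) (D E : Set (Fin n → ℝ)) : Prop :=
  ∃ u : List (Fin n), DefinedFrom step D u ∧ run step D u = E

variable {step : Set (Fin n → ℝ) → Fin n → Set (Fin n → ℝ)} {D E F : Set (Fin n → ℝ)}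

lemma Leads.refl : Leads step D D := ⟨[], trivial, rfl⟩

lemma Leads.trans (h : Leads step D E) (h' : Leads step E F) : Leads step D F := by
  obtain ⟨u, hu, rfl⟩ := h
  obtain ⟨w, hw, rfl⟩ := h'
  exact ⟨u ++ w, (definedFrom_append _ _ _ _).2 ⟨hu, hw⟩, by simp [run]⟩

lemma Leads.single {i : Fin n} (h : simpleRoot i ∉ D) : Leads step D (step D i) :=
  ⟨[i], ⟨h, trivial⟩, rfl⟩

end Paths

section Walks

variable {n : ℕ} {M : CoxeterMatrix (Fin n)}

lemma isSmallRoot_of_mem_stepGeo {D : Set (Fin n → ℝ)} {i : Fin n} {v : Fin n → ℝ}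
    (hv : v ∈ stepGeo M D i) : IsSmallRoot M v := by
  rcases hv with rfl | ⟨-, h⟩
  · exact .simple i
  · exact h

lemma isSmallRoot_of_mem_run {D : Set (Fin n → ℝ)} (hD : ∀ v ∈ D, IsSmallRoot M v)
    (u : List (Fin n)) : ∀ v ∈ run (stepGeo M) D u, IsSmallRoot M v := by
  induction u generalizing D with
  | nil => exact hD
  | cons i u ih => exact ih fun _ => isSmallRoot_of_mem_stepGeo

lemma simpleRoot_mem_stepGeo (D : Set (Fin n → ℝ)) (i : Fin n) :
    simpleRoot i ∈ stepGeo M D i := Set.mem_insert _ _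

lemma simpleRefl_apply_ne_zero_of_eq {i j : Fin n} (hM : M i j = 0) {v : Fin n → ℝ}
    (h : simpleRefl M i v = simpleRoot j) : v i ≠ 0 ∧ v j ≠ 0 := by
  have hne := ne_of_eq_zero hM
  have hM' : M j i = 0 := by rw [M.symmetric]; exact hM
  have hoff : ∀ k, k ≠ i → v k = (simpleRoot j : Fin n → ℝ) k := fun k hk => by
    rw [← h, simpleRefl_apply_of_ne M hk]
  have hi : v i - 2 * bform M v (simpleRoot i) = 0 := by
    rw [← simpleRefl_apply_self, h]; simp [simpleRoot, hne]
  have hB : bform M v (simpleRoot i) = v i - 1 := by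
    rw [bform_simpleRoot, ← Finset.add_sum_erase _ _ (Finset.mem_univ i), gramEntry_self,
      Finset.sum_eq_single j]
    · rw [hoff j hne.symm, gramEntry_of_eq_zero M hM']; simp [simpleRoot]; ring
    · intro k hk hkj
      rw [hoff k (Finset.ne_of_mem_erase hk)]; simp [simpleRoot, hkj]
    · simp [hne.symm]
  refine ⟨fun h0 => ?_, by rw [hoff j hne.symm]; simp [simpleRoot]⟩
  rw [hB, h0] at hi
  norm_num at hi

/-- After reading the letter `i`, the letter `j` can be read if `{i, j}` is an `∞`-edge. -/
lemma simpleRoot_notMem_stepGeo {D : Set (Fin n → ℝ)} (hD : ∀ v ∈ D, IsSmallRoot M v)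
    {i j : Fin n} (hM : M i j = 0) : simpleRoot j ∉ stepGeo M D i := by
  rintro (h | ⟨⟨v, hv, h⟩, -⟩)
  · have := congrFun h j
    simp [simpleRoot, (ne_of_eq_zero hM).symm] at this
  · obtain ⟨hi, hj⟩ := simpleRefl_apply_ne_zero_of_eq hM h
    exact ((hD v hv).eq_zero_or_eq_zero i j hM).elim hi hj

/-- The state `D` has just been entered by the letter `i`, and the support of every element of
`D` is disjoint from `S \ {i}`. -/
def ClearedAt (M : CoxeterMatrix (Fin n)) (S : Set (Fin n)) (i : Fin n)
    (D : Set (Fin n → ℝ)) : Prop :=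
  (∃ D₀, (∀ v ∈ D₀, IsSmallRoot M v) ∧ D = stepGeo M D₀ i) ∧
    ∀ v ∈ D, ∀ k ∈ S, k ≠ i → v k = 0

/-- Following an `∞`-edge `{i, j}` removes from the state all roots with `i` in their
support. -/
lemma ClearedAt.step {S : Set (Fin n)} {i j : Fin n} {D : Set (Fin n → ℝ)}
    (h : ClearedAt M S i D) (hM : M i j = 0) :
    Leads (stepGeo M) D (stepGeo M D j) ∧ ClearedAt M (insert i S) j (stepGeo M D j) := by
  obtain ⟨⟨D₀, hD₀, rfl⟩, hS⟩ := h
  have hsmall : ∀ v ∈ stepGeo M D₀ i, IsSmallRoot M v := fun _ => isSmallRoot_of_mem_stepGeo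
  refine ⟨.single (simpleRoot_notMem_stepGeo hD₀ hM), ⟨_, hsmall, rfl⟩, ?_⟩
  rintro v (rfl | ⟨⟨w, hw, rfl⟩, hs⟩) k hk hkj
  · simp [simpleRoot, hkj]
  · rw [simpleRefl_apply_of_ne M hkj]
    have hwi : w i = 0 := by
      by_contra hwi
      exact (hsmall w hw).not_isSmallRoot_simpleRefl hM hwi hs
    rcases eq_or_ne k i with rfl | hki
    · exact hwi
    · exact hS w hw k (hk.resolve_left hki) hki

lemma infGraph_adj {i j : Fin n} (h : (infGraph M).Adj i j) : M i j = 0 := by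
  rcases h with ⟨-, h | h⟩
  · exact h
  · rw [M.symmetric]; exact h

lemma ClearedAt.walk {S : Set (Fin n)} {i j : Fin n} (p : (infGraph M).Walk i j)
    {D : Set (Fin n → ℝ)} (h : ClearedAt M S i D) :
    ∃ E, Leads (stepGeo M) D E ∧ ClearedAt M (insert j S) j E := by
  induction p generalizing S D with
  | nil =>
    exact ⟨D, .refl, h.1, fun v hv k hk hki => h.2 v hv k (hk.resolve_left hki) hki⟩
  | cons hadj p ih =>
    obtain ⟨hlead, hclear⟩ := h.step (infGraph_adj hadj)
    obtain ⟨E, hE, hcE⟩ := ih hclear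
    refine ⟨E, hlead.trans hE, hcE.1, fun v hv k hk hkj => hcE.2 v hv k ?_ hkj⟩
    exact hk.imp_right (Set.mem_insert_of_mem _)

lemma ClearedAt.exists_finset (hspan : (infGraph M).Connected) {i : Fin n}
    {D : Set (Fin n → ℝ)} (h : ClearedAt M ∅ i D) (S : Finset (Fin n)) :
    ∃ j E, Leads (stepGeo M) D E ∧ ClearedAt M S j E := by
  induction S using Finset.induction_on with
  | empty => exact ⟨i, D, .refl, by simpa using h⟩
  | insert a S _ ih =>
    obtain ⟨j, E, hE, hcE⟩ := ih
    obtain ⟨p⟩ := hspan.preconnected j a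
    obtain ⟨F, hF, hcF⟩ := hcE.walk p
    exact ⟨a, F, hE.trans hF, by simpa using hcF⟩

/-- Every state entered by a letter leads to every singleton `{α_j}`. -/
lemma ClearedAt.leads_singleton (hspan : (infGraph M).Connected) {i : Fin n}
    {D : Set (Fin n → ℝ)} (h : ClearedAt M ∅ i D) (j : Fin n) :
    Leads (stepGeo M) D {simpleRoot j} := by
  obtain ⟨k, E, hE, hcE⟩ := h.exists_finset hspan Finset.univ
  obtain ⟨p⟩ := hspan.preconnected k j
  obtain ⟨F, hF, ⟨F₀, -, rfl⟩, hcF⟩ := hcE.walk p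
  have hsingle : stepGeo M F₀ j = {simpleRoot j} := by
    refine Set.eq_singleton_iff_unique_mem.2 ⟨simpleRoot_mem_stepGeo _ _, fun v hv => ?_⟩
    exact (isSmallRoot_of_mem_stepGeo hv).eq_simpleRoot j fun l hl => hcF v hv l (by simp) hl
  exact hsingle ▸ hE.trans hF

end Walks

/-- If `M` is `∞`-spanned and the indexing is adapted as in the Labelling lemma, then the
geo automaton with the start state `∅` removed is strongly connected: any reachable
non-fail state `D'` other than `∅` can be reached from any reachable non-fail state `D`
other than `∅` by reading some word all of whose transitions are defined. -/
theorem strongly_connected_geo {n : ℕ} (hn : 3 ≤ n) (M : CoxeterMatrix (Fin n))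
    (hspan : (infGraph M).Connected) (hadapt : AdaptedLabelling hn M) :
    ∀ D D' : Set (Fin n → ℝ), Reachable (stepGeo M) D → Reachable (stepGeo M) D' →
      D ≠ ∅ → D' ≠ ∅ →
      ∃ u : List (Fin n), DefinedFrom (stepGeo M) D u ∧ run (stepGeo M) D u = D' := by
  rintro D D' ⟨u, -, rfl⟩ ⟨w, hw, rfl⟩ hD hD'
  rcases List.eq_nil_or_concat u with rfl | ⟨u', i, rfl⟩
  · exact absurd rfl hD
  cases w with
  | nil => exact absurd rfl hD'
  | cons j w =>
    have hclear : ClearedAt M ∅ i (run (stepGeo M) ∅ (u' ++ [i])) :=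
      ⟨⟨run (stepGeo M) ∅ u', isSmallRoot_of_mem_run (by simp) u', by simp [run]⟩, by simp⟩
    have hstart : stepGeo M ∅ j = {simpleRoot j} := by simp [stepGeo]
    have htail : Leads (stepGeo M) {simpleRoot j} (run (stepGeo M) ∅ (j :: w)) :=
      ⟨w, hstart ▸ hw.2, by rw [← hstart]; rfl⟩
    simpa [Leads] using (hclear.leads_singleton hspan j).trans htail
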